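/- Let d ≥ 6 be an even integer and r ≥ 2. Then there exists a nonzero homogeneous polynomial f of degree d in x_0,…,x_r over K such that sr(f) = 3d/2 and S(f) has exactly two elements: there are exactly two sets of points of ℙ^r of cardinality 3d/2 computing the symmetric rank of f. -/

import Mathlib

open MvPolynomial

/-- The degree-`d` power of (a representative linear form of) a point of `ℙ^r`,
regarded as a homogeneous polynomial of degree `d` in `x_0, …, x_r`. -/
noncomputable def powForm (K : Type) [Field K] (r d : ℕ)
    (p : Projectivization K (Fin (r + 1) → K)) : MvPolynomial (Fin (r + 1)) K :=
  (∑ i, MvPolynomial.C (p.rep i) * MvPolynomial.X i) ^ d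

/-- The span of the `d`-th powers of the linear forms corresponding to a set of
points of `ℙ^r`. -/
noncomputable def decompSpan (K : Type) [Field K] (r d : ℕ)
    (S : Set (Projectivization K (Fin (r + 1) → K))) :
    Submodule K (MvPolynomial (Fin (r + 1)) K) :=
  Submodule.span K (powForm K r d '' S)

/-- The symmetric rank of `f`. -/
noncomputable def symRank (K : Type) [Field K] (r d : ℕ)
    (f : MvPolynomial (Fin (r + 1)) K) : ℕ :=
  sInf {n | ∃ A : Finset (Projectivization K (Fin (r + 1) → K)),
    A.card = n ∧ f ∈ decompSpan K r d ↑A}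

/-- `S(f)`: the set of decompositions of `f`, i.e. finite sets of points of `ℙ^r`
computing the symmetric rank of `f`. -/
def decompSet (K : Type) [Field K] (r d : ℕ) (f : MvPolynomial (Fin (r + 1)) K) :
    Set (Finset (Projectivization K (Fin (r + 1) → K))) :=
  {A | f ∈ decompSpan K r d ↑A ∧ A.card = symRank K r d f}

/-- The points of `ℙ^r` lying on the hypersurface `Z(q)`. -/
def projZeros (K : Type) [Field K] (r : ℕ) (q : MvPolynomial (Fin (r + 1)) K) :
    Set (Projectivization K (Fin (r + 1) → K)) :=
  {p | MvPolynomial.eval p.rep q = 0}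

/-- A line of `ℙ^r`. -/
def IsProjLine (K : Type) [Field K] (r : ℕ)
    (L : Set (Projectivization K (Fin (r + 1) → K))) : Prop :=
  ∃ W : Submodule K (Fin (r + 1) → K), Module.finrank K W = 2 ∧
    L = {p | p.rep ∈ W}

/-- A smooth conic of `ℙ^r`. -/
def IsSmoothConic (K : Type) [Field K] (r : ℕ)
    (C : Set (Projectivization K (Fin (r + 1) → K))) : Prop :=
  ∃ u v w : Fin (r + 1) → K, LinearIndependent K ![u, v, w] ∧
    C = {p | ∃ s t : K, (s ≠ 0 ∨ t ≠ 0) ∧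
      p.submodule = Submodule.span K {s ^ 2 • u + (s * t) • v + t ^ 2 • w}}

/-- The linear form with coefficient vector `v`. -/
noncomputable def linForm {K : Type} [Field K] {r : ℕ} (v : Fin (r + 1) → K) :
    MvPolynomial (Fin (r + 1)) K :=
  ∑ i, MvPolynomial.C (v i) * MvPolynomial.X i

section LinForm

variable {K : Type} [Field K] {r d : ℕ}

theorem powForm_eq (p : Projectivization K (Fin (r + 1) → K)) :
    powForm K r d p = linForm p.rep ^ d := rfl

theorem linForm_smul (a : K) (v : Fin (r + 1) → K) : linForm (a • v) = C a * linForm v := by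
  simp [linForm, Finset.mul_sum, mul_assoc]

theorem isHomogeneous_linForm (v : Fin (r + 1) → K) : (linForm v).IsHomogeneous 1 :=
  IsHomogeneous.sum _ _ _ fun i _ => by
    simpa using (isHomogeneous_C (Fin (r + 1)) (v i)).mul (isHomogeneous_X K i)

theorem coeff_linForm_pow (v : Fin (r + 1) → K) (m : Fin (r + 1) →₀ ℕ) :
    coeff m (linForm v ^ d) =
      if m.degree = d then m.multinomial * eval v (monomial m 1) else 0 := by
  have := coeff_linearCombination_X_pow_of_fintype v m d
  simp only [smul_eq_C_mul] at this
  rw [linForm, this]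
  simp [eval_monomial, Finsupp.degree_apply, Finsupp.sum]

theorem degree_eq_of_mem_support {G : MvPolynomial (Fin (r + 1)) K} (hG : G.IsHomogeneous d)
    {m : Fin (r + 1) →₀ ℕ} (hm : m ∈ G.support) : m.degree = d := by
  have := hG (mem_support_iff.mp hm)
  rw [Finsupp.degree_eq_weight_one]
  exact this

theorem eval_smul_of_isHomogeneous {G : MvPolynomial (Fin (r + 1)) K} (hG : G.IsHomogeneous d)
    (a : K) (v : Fin (r + 1) → K) : eval (a • v) G = a ^ d * eval v G := by
  rw [eval_eq, eval_eq, Finset.mul_sum]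
  refine Finset.sum_congr rfl fun m hm => ?_
  have hdeg : ∑ i ∈ m.support, m i = d :=
    degree_eq_of_mem_support hG hm
  simp only [Pi.smul_apply, smul_eq_mul, mul_pow, Finset.prod_mul_distrib, Finset.prod_pow_eq_pow_sum,
    hdeg]
  ring

theorem exists_apolar_functional [CharZero K] {G : MvPolynomial (Fin (r + 1)) K}
    (hG : G.IsHomogeneous d) :
    ∃ T : MvPolynomial (Fin (r + 1)) K →ₗ[K] K, ∀ v, T (linForm v ^ d) = eval v G := by
  refine ⟨∑ m ∈ G.support, (coeff m G / (m.multinomial : K)) • lcoeff K m, fun v => ?_⟩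
  simp only [LinearMap.sum_apply, LinearMap.smul_apply, lcoeff_apply, coeff_linForm_pow, smul_eq_mul]
  rw [eval_eq]
  refine Finset.sum_congr rfl fun m hm => ?_
  have hdeg : m.degree = d :=
    degree_eq_of_mem_support hG hm
  have hne : (m.multinomial : K) ≠ 0 := by
    rw [Finsupp.multinomial_eq]
    exact_mod_cast (Nat.multinomial_pos _ _).ne'
  rw [if_pos hdeg, eval_monomial, Finsupp.prod]
  field_simp

theorem sum_eval_eq_of_sum_linForm_pow_eq [CharZero K] {ι κ : Type*} {s : Finset ι} {t : Finset κ}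
    {a : ι → K} {b : κ → K} {v : ι → Fin (r + 1) → K} {w : κ → Fin (r + 1) → K}
    (h : ∑ i ∈ s, a i • linForm (v i) ^ d = ∑ j ∈ t, b j • linForm (w j) ^ d)
    {G : MvPolynomial (Fin (r + 1)) K} (hG : G.IsHomogeneous d) :
    ∑ i ∈ s, a i * eval (v i) G = ∑ j ∈ t, b j * eval (w j) G := by
  obtain ⟨T, hT⟩ := exists_apolar_functional hG
  simpa [hT] using congrArg T h

theorem sum_linForm_pow_eq_of_sum_eval_eq {ι κ : Type*} {s : Finset ι} {t : Finset κ}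
    {a : ι → K} {b : κ → K} {v : ι → Fin (r + 1) → K} {w : κ → Fin (r + 1) → K}
    (h : ∀ G : MvPolynomial (Fin (r + 1)) K, G.IsHomogeneous d →
      ∑ i ∈ s, a i * eval (v i) G = ∑ j ∈ t, b j * eval (w j) G) :
    ∑ i ∈ s, a i • linForm (v i) ^ d = ∑ j ∈ t, b j • linForm (w j) ^ d := by
  ext m
  simp only [coeff_sum, coeff_smul, coeff_linForm_pow, smul_eq_mul]
  by_cases hm : m.degree = d
  · have := h (monomial m 1) (isHomogeneous_monomial 1 hm)
    simp only [hm, if_true, mul_left_comm _ (m.multinomial : K), ← Finset.mul_sum, this]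
  · simp [hm]

end LinForm

/-- The polynomials of degree at most `3 * m` with equal coefficients in degrees `0` and `3 * m`:
the restrictions of forms of degree `m` to the nodal cubic parametrized by `(1 + t ^ 3, t, t ^ 2)`. -/
def nodalSubmodule (K : Type) [Field K] (m : ℕ) : Submodule K (Polynomial K) where
  carrier := {h | h.natDegree ≤ 3 * m ∧ h.coeff 0 = h.coeff (3 * m)}
  zero_mem' := by simp
  add_mem' := by
    rintro a b ⟨ha, ha'⟩ ⟨hb, hb'⟩
    exact ⟨Polynomial.natDegree_add_le_of_degree_le ha hb, by simp [ha', hb']⟩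
  smul_mem' := by
    rintro c a ⟨ha, ha'⟩
    exact ⟨(Polynomial.natDegree_smul_le c a).trans ha, by simp [ha']⟩

/-- The parametrization of the nodal cubic `x₀ x₁ x₂ = x₁ ^ 3 + x₂ ^ 3` in the plane spanned by the
first three coordinates. -/
noncomputable def nodalCurve (K : Type) [Field K] (r : ℕ) (i : Fin (r + 1)) : Polynomial K :=
  if i.val = 0 then 1 + Polynomial.X ^ 3
  else if i.val = 1 then Polynomial.X
  else if i.val = 2 then Polynomial.X ^ 2 else 0

/-- The point of the nodal cubic with parameter `t`. -/
noncomputable def nodalPoint (K : Type) [Field K] (r : ℕ) (t : K) : Fin (r + 1) → K :=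
  fun i => (nodalCurve K r i).eval t

section Nodal

variable {K : Type} [Field K] {r : ℕ}

theorem mem_nodalSubmodule {m : ℕ} {h : Polynomial K} :
    h ∈ nodalSubmodule K m ↔ h.natDegree ≤ 3 * m ∧ h.coeff 0 = h.coeff (3 * m) := Iff.rfl

theorem mul_mem_nodalSubmodule {m l : ℕ} {g h : Polynomial K} (hg : g ∈ nodalSubmodule K m)
    (hh : h ∈ nodalSubmodule K l) : g * h ∈ nodalSubmodule K (m + l) := by
  obtain ⟨hg, hg'⟩ := hg
  obtain ⟨hh, hh'⟩ := hh
  refine ⟨Polynomial.natDegree_mul_le.trans (by omega), ?_⟩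
  rw [mul_add, Polynomial.coeff_mul_add_eq_of_natDegree_le hg hh, Polynomial.mul_coeff_zero, hg',
    hh']

theorem one_mem_nodalSubmodule : (1 : Polynomial K) ∈ nodalSubmodule K 0 := by
  simp [mem_nodalSubmodule]

theorem pow_mem_nodalSubmodule {m : ℕ} {g : Polynomial K} (hg : g ∈ nodalSubmodule K m) (e : ℕ) :
    g ^ e ∈ nodalSubmodule K (e * m) := by
  induction e with
  | zero => simpa using one_mem_nodalSubmodule
  | succ e ih =>
    rw [pow_succ, add_mul, one_mul]
    exact mul_mem_nodalSubmodule ih hg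

theorem X_pow_mem_nodalSubmodule {m j : ℕ} (hj : 0 < j) (hjm : j < 3 * m) :
    (Polynomial.X ^ j : Polynomial K) ∈ nodalSubmodule K m := by
  refine ⟨by simpa using hjm.le, ?_⟩
  rw [Polynomial.coeff_X_pow, Polynomial.coeff_X_pow, if_neg (by omega), if_neg (by omega)]

theorem one_add_X_pow_mem_nodalSubmodule {m : ℕ} (hm : 0 < m) :
    (1 + Polynomial.X ^ (3 * m) : Polynomial K) ∈ nodalSubmodule K m := by
  refine ⟨Polynomial.natDegree_add_le_of_degree_le (by simp) (by simp), ?_⟩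
  have : 3 * m ≠ 0 := by omega
  simp [Polynomial.coeff_X_pow, Polynomial.coeff_one, this, this.symm]

theorem nodalCurve_mem (i : Fin (r + 1)) : nodalCurve K r i ∈ nodalSubmodule K 1 := by
  unfold nodalCurve
  split_ifs
  · exact one_add_X_pow_mem_nodalSubmodule one_pos
  · simpa using X_pow_mem_nodalSubmodule (K := K) (m := 1) (j := 1) (by omega) (by omega)
  · exact X_pow_mem_nodalSubmodule (by omega) (by omega)
  · exact zero_mem _

theorem aeval_nodalCurve_mem {m : ℕ} {G : MvPolynomial (Fin (r + 1)) K} (hG : G.IsHomogeneous m) :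
    aeval (nodalCurve K r) G ∈ nodalSubmodule K m := by
  rw [aeval_def, eval₂_eq]
  refine Submodule.sum_mem _ fun s hs => ?_
  rw [← Algebra.smul_def]
  refine Submodule.smul_mem _ _ ?_
  have hdeg : ∑ i ∈ s.support, s i = m :=
    degree_eq_of_mem_support hG hs
  rw [← hdeg]
  clear hdeg hs
  induction s.support using Finset.induction_on with
  | empty => simpa using one_mem_nodalSubmodule
  | insert i t hi ih =>
    rw [Finset.prod_insert hi, Finset.sum_insert hi]
    refine mul_mem_nodalSubmodule ?_ ih
    simpa using pow_mem_nodalSubmodule (nodalCurve_mem i) (s i)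

theorem eval_nodalPoint (t : K) (G : MvPolynomial (Fin (r + 1)) K) :
    eval (nodalPoint K r t) G = (aeval (nodalCurve K r) G).eval t := by
  induction G using MvPolynomial.induction_on with
  | C a => simp
  | add p q hp hq => simp [hp, hq]
  | mul_X p i hp => simp [hp, nodalPoint]

theorem exists_isHomogeneous_aeval_eq_X_pow (hr : 2 ≤ r) {m : ℕ} (hm : 0 < m) :
    (∀ j, 0 < j → j < 3 * m → ∃ G : MvPolynomial (Fin (r + 1)) K,
      G.IsHomogeneous m ∧ aeval (nodalCurve K r) G = Polynomial.X ^ j) ∧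
    ∃ G : MvPolynomial (Fin (r + 1)) K,
      G.IsHomogeneous m ∧ aeval (nodalCurve K r) G = 1 + Polynomial.X ^ (3 * m) := by
  let i0 : Fin (r + 1) := ⟨0, by omega⟩
  let i1 : Fin (r + 1) := ⟨1, by omega⟩
  let i2 : Fin (r + 1) := ⟨2, by omega⟩
  have e0 : aeval (nodalCurve K r) (X i0 : MvPolynomial (Fin (r + 1)) K)
      = 1 + Polynomial.X ^ 3 := by simp [nodalCurve, i0]
  have e1 : aeval (nodalCurve K r) (X i1 : MvPolynomial (Fin (r + 1)) K)
      = Polynomial.X := by simp [nodalCurve, i1]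
  have e2 : aeval (nodalCurve K r) (X i2 : MvPolynomial (Fin (r + 1)) K)
      = Polynomial.X ^ 2 := by simp [nodalCurve, i2]
  clear_value i0 i1 i2
  induction m, hm using Nat.le_induction with
  | base =>
    refine ⟨fun j hj hj3 => ?_, X i0, isHomogeneous_X _ _, e0⟩
    obtain rfl | rfl : j = 1 ∨ j = 2 := by omega
    · exact ⟨X i1, isHomogeneous_X _ _, by simpa using e1⟩
    · exact ⟨X i2, isHomogeneous_X _ _, e2⟩
  | succ m hm ih =>
    obtain ⟨ih, G₀, hG₀, eG₀⟩ := ih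
    have mid : ∀ j, 2 ≤ j → j ≤ 3 * m + 1 → ∃ G : MvPolynomial (Fin (r + 1)) K,
        G.IsHomogeneous (m + 1) ∧ aeval (nodalCurve K r) G = Polynomial.X ^ j := by
      intro j hj hj'
      by_cases h : j ≤ 3 * m
      · obtain ⟨G, hG, eG⟩ := ih (j - 1) (by omega) (by omega)
        refine ⟨G * X i1, hG.mul (isHomogeneous_X _ _), ?_⟩
        rw [map_mul, eG, e1, ← pow_succ]
        congr 1; omega
      · obtain ⟨G, hG, eG⟩ := ih (j - 2) (by omega) (by omega)
        refine ⟨G * X i2, hG.mul (isHomogeneous_X _ _), ?_⟩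
        rw [map_mul, eG, e2, ← pow_add]
        congr 1; omega
    refine ⟨fun j hj hj' => ?_, ?_⟩
    · rcases (by omega : j = 1 ∨ (2 ≤ j ∧ j ≤ 3 * m + 1) ∨ j = 3 * m + 2) with rfl | h | rfl
      · obtain ⟨G, hG, eG⟩ := mid (3 * m + 1) (by omega) le_rfl
        refine ⟨G₀ * X i1 - G, (hG₀.mul (isHomogeneous_X _ _)).sub hG, ?_⟩
        rw [map_sub, map_mul, eG, eG₀, e1]
        ring
      · exact mid j h.1 h.2
      · obtain ⟨G, hG, eG⟩ := mid 2 le_rfl (by omega)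
        refine ⟨G₀ * X i2 - G, (hG₀.mul (isHomogeneous_X _ _)).sub hG, ?_⟩
        rw [map_sub, map_mul, eG, eG₀, e2]
        ring
    · obtain ⟨G, hG, eG⟩ := mid 3 (by omega) (by omega)
      obtain ⟨G', hG', eG'⟩ := mid (3 * m) (by omega) (by omega)
      refine ⟨G₀ * X i0 - G - G', ((hG₀.mul (isHomogeneous_X _ _)).sub hG).sub hG', ?_⟩
      rw [map_sub, map_sub, map_mul, eG, eG', eG₀, e0]
      ring

theorem exists_isHomogeneous_aeval_eq (hr : 2 ≤ r) {m : ℕ} (hm : 0 < m) {h : Polynomial K}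
    (hh : h ∈ nodalSubmodule K m) : ∃ G : MvPolynomial (Fin (r + 1)) K,
      G.IsHomogeneous m ∧ aeval (nodalCurve K r) G = h := by
  obtain ⟨hX, G₀, hG₀, eG₀⟩ := exists_isHomogeneous_aeval_eq_X_pow (K := K) hr hm
  choose! G hG eG using hX
  have key : h = h.coeff 0 • (1 + Polynomial.X ^ (3 * m)) +
      ∑ j ∈ Finset.Ioo 0 (3 * m), h.coeff j • Polynomial.X ^ j := by
    ext i
    simp only [Polynomial.coeff_add, Polynomial.coeff_smul, Polynomial.finsetSum_coeff,
      Polynomial.coeff_X_pow, Polynomial.coeff_one, smul_eq_mul, mul_ite, mul_one, mul_zero,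
      Finset.sum_ite_eq, Finset.mem_Ioo]
    rcases Nat.lt_trichotomy i (3 * m) with hi | rfl | hi
    · rcases Nat.eq_zero_or_pos i with rfl | hi0
      · simp [hm.ne']
      · simp [hi0, hi, hi0.ne', hi.ne]
    · simp [hm.ne', hh.2]
    · rw [Polynomial.coeff_eq_zero_of_natDegree_lt (hh.1.trans_lt hi)]
      simp [hi.ne', hi.not_gt, (Nat.zero_le _).trans_lt hi |>.ne']
  refine ⟨h.coeff 0 • G₀ + ∑ j ∈ Finset.Ioo 0 (3 * m), h.coeff j • G j, ?_, ?_⟩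
  · refine Submodule.add_mem (homogeneousSubmodule _ K m) (Submodule.smul_mem _ _ hG₀)
      (Submodule.sum_mem _ fun j hj => Submodule.smul_mem _ _ ?_)
    rw [Finset.mem_Ioo] at hj
    exact hG j hj.1 hj.2
  · rw [map_add, map_smul, eG₀, map_sum]
    conv_rhs => rw [key]
    congr 1
    refine Finset.sum_congr rfl fun j hj => ?_
    rw [Finset.mem_Ioo] at hj
    rw [map_smul, eG j hj.1 hj.2]

end Nodal

section RootSums

variable {K : Type} [Field K] [IsAlgClosed K] [CharZero K]

theorem exists_isPrimitiveRoot_and_pow_eq {n : ℕ} (hn : 0 < n) (a : K) :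
    ∃ ζ b : K, IsPrimitiveRoot ζ n ∧ b ^ n = a := by
  have : NeZero n := ⟨hn.ne'⟩
  have : NeZero (n : K) := ⟨by exact_mod_cast hn.ne'⟩
  obtain ⟨ζ, hζ⟩ := HasEnoughRootsOfUnity.exists_primitiveRoot K n
  obtain ⟨b, hb⟩ := IsAlgClosed.exists_pow_nat_eq a hn
  exact ⟨ζ, b, hζ, hb⟩

theorem card_nthRootsFinset_of_ne_zero {n : ℕ} (hn : 0 < n) {a : K} (ha : a ≠ 0) :
    (Polynomial.nthRootsFinset n a).card = n := by
  classical
  obtain ⟨ζ, b, hζ, hb⟩ := exists_isPrimitiveRoot_and_pow_eq hn a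
  rw [Polynomial.nthRootsFinset_def, Multiset.toFinset_card_of_nodup (hζ.nthRoots_nodup ha),
    hζ.nthRoots_eq hb]
  simp

theorem sum_pow_nthRootsFinset_eq_zero {n j : ℕ} (hj : 0 < j) (hjn : j < n) {a : K} (ha : a ≠ 0) :
    ∑ t ∈ Polynomial.nthRootsFinset n a, t ^ j = 0 := by
  classical
  obtain ⟨ζ, b, hζ, hb⟩ := exists_isPrimitiveRoot_and_pow_eq (hj.trans hjn) a
  have hne : ζ ^ j ≠ 1 := hζ.pow_ne_one_of_pos_of_lt hj.ne' hjn
  have hgeom : ∑ i ∈ Finset.range n, (ζ ^ j) ^ i = 0 := by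
    have := mul_neg_geom_sum (ζ ^ j) n
    rw [← pow_mul, mul_comm j n, pow_mul, hζ.pow_eq_one, one_pow, sub_self, mul_eq_zero] at this
    exact this.resolve_left (sub_ne_zero.mpr hne.symm)
  have hsum : ∑ t ∈ Polynomial.nthRootsFinset n a, t ^ j =
      ∑ i ∈ Finset.range n, (ζ ^ i * b) ^ j := by
    rw [Polynomial.nthRootsFinset_def, Finset.sum, Multiset.toFinset_val,
      (hζ.nthRoots_nodup ha).dedup, hζ.nthRoots_eq hb, Multiset.map_map]
    rfl
  simp_rw [hsum, mul_pow, pow_right_comm ζ _ j, ← Finset.sum_mul, hgeom, zero_mul]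

theorem sum_pow_nthRootsFinset {n j : ℕ} (hn : 0 < n) (hj : j ≤ 2 * n) {a : K} (ha : a ≠ 0) :
    ∑ t ∈ Polynomial.nthRootsFinset n a, t ^ j =
      (if j = 0 then (n : K) else 0) + (if j = n then n * a else 0) +
        (if j = 2 * n then n * a ^ 2 else 0) := by
  have key : ∀ i, ∑ t ∈ Polynomial.nthRootsFinset n a, t ^ (n + i) =
      a * ∑ t ∈ Polynomial.nthRootsFinset n a, t ^ i := by
    intro i
    rw [Finset.mul_sum]
    refine Finset.sum_congr rfl fun t ht => ?_
    rw [pow_add, (Polynomial.mem_nthRootsFinset hn a).mp ht]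
  have zero : ∑ t ∈ Polynomial.nthRootsFinset n a, t ^ 0 = (n : K) := by
    simp [card_nthRootsFinset_of_ne_zero hn ha]
  have self : ∑ t ∈ Polynomial.nthRootsFinset n a, t ^ n = a * n := by
    rw [← zero, ← key, add_zero]
  rcases (by omega : j = 0 ∨ (0 < j ∧ j < n) ∨ j = n ∨ (n < j ∧ j < 2 * n) ∨ j = 2 * n) with
    rfl | h | rfl | h | rfl
  · rw [zero, if_pos rfl, if_neg (by omega), if_neg (by omega)]
    ring
  · rw [sum_pow_nthRootsFinset_eq_zero h.1 h.2 ha, if_neg (by omega), if_neg (by omega),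
      if_neg (by omega)]
    ring
  · rw [self, if_neg (by omega), if_pos rfl, if_neg (by omega)]
    ring
  · obtain ⟨i, rfl⟩ := Nat.exists_eq_add_of_lt h.1
    rw [add_assoc, key, sum_pow_nthRootsFinset_eq_zero (by omega) (by omega) ha,
      if_neg (by omega), if_neg (by omega), if_neg (by omega)]
    ring
  · rw [two_mul, key, self, if_neg (by omega), if_neg (by omega), if_pos rfl]
    ring

theorem sum_eval_nthRootsFinset {k : ℕ} (hk : 0 < k) {a : K} (ha : a ≠ 0) {h : Polynomial K}
    (hh : h ∈ nodalSubmodule K (k + k)) :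
    ∑ t ∈ Polynomial.nthRootsFinset (3 * k) a, h.eval t =
      (3 * k : ℕ) * a * ((a + a⁻¹) * h.coeff 0 + h.coeff (3 * k)) := by
  obtain ⟨hdeg, hh⟩ := hh
  rw [show 3 * (k + k) = 2 * (3 * k) by ring] at hdeg hh
  simp_rw [Polynomial.eval_eq_sum_range' (Nat.lt_succ_of_le hdeg)]
  rw [Finset.sum_comm]
  simp_rw [← Finset.mul_sum]
  have : ∀ j ∈ Finset.range (2 * (3 * k)).succ,
      h.coeff j * ∑ t ∈ Polynomial.nthRootsFinset (3 * k) a, t ^ j = _ := fun j hj => by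
    rw [sum_pow_nthRootsFinset (by omega) (by simpa [Nat.lt_succ_iff] using hj) ha]
  rw [Finset.sum_congr rfl this]
  simp only [mul_add, Finset.sum_add_distrib, mul_ite, mul_zero, Finset.sum_ite_eq',
    Finset.mem_range]
  rw [if_pos (by omega), if_pos (by omega), if_pos (by omega), ← hh]
  field_simp
  ring

end RootSums

section NodalForm

variable {K : Type} [Field K] {r k : ℕ}

/-- The sum of the powers of the linear forms attached to the points of the nodal cubic whose
parameters are the `3 * k`-th roots of `a`. -/
noncomputable def nodalForm (K : Type) [Field K] (r k : ℕ) (a : K) :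
    MvPolynomial (Fin (r + 1)) K :=
  ∑ t ∈ Polynomial.nthRootsFinset (3 * k) a, linForm (nodalPoint K r t) ^ (k + k)

theorem isHomogeneous_nodalForm (a : K) : (nodalForm K r k a).IsHomogeneous (k + k) :=
  IsHomogeneous.sum _ _ _ fun t _ => by
    simpa using (isHomogeneous_linForm (nodalPoint K r t)).pow (k + k)

theorem sum_eval_nodalPoint [IsAlgClosed K] [CharZero K] (hk : 0 < k) {a : K} (ha : a ≠ 0)
    {G : MvPolynomial (Fin (r + 1)) K} (hG : G.IsHomogeneous (k + k)) :
    ∑ t ∈ Polynomial.nthRootsFinset (3 * k) a, eval (nodalPoint K r t) G =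
      (3 * k : ℕ) * a * ((a + a⁻¹) * (aeval (nodalCurve K r) G).coeff 0 +
        (aeval (nodalCurve K r) G).coeff (3 * k)) := by
  simp_rw [eval_nodalPoint]
  exact sum_eval_nthRootsFinset hk ha (aeval_nodalCurve_mem hG)

theorem smul_nodalForm_inv [IsAlgClosed K] [CharZero K] (hk : 0 < k) {a : K} (ha : a ≠ 0) :
    a ^ 2 • nodalForm K r k a⁻¹ = nodalForm K r k a := by
  have := sum_linForm_pow_eq_of_sum_eval_eq (d := k + k) (v := nodalPoint K r)
    (w := nodalPoint K r) (s := Polynomial.nthRootsFinset (3 * k) a⁻¹)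
    (t := Polynomial.nthRootsFinset (3 * k) a) (a := fun _ => a ^ 2) (b := fun _ => 1)
    (fun G hG => by
      rw [← Finset.mul_sum, ← Finset.mul_sum, sum_eval_nodalPoint hk ha hG,
        sum_eval_nodalPoint hk (inv_ne_zero ha) hG, inv_inv]
      field_simp
      ring)
  simpa [nodalForm, Finset.smul_sum] using this

/-- The evaluations of the forms of degree `k + k` at the points of `A`, with weights `c`, compute
the functional `h ↦ s * h₀ + h₃ₖ` of the restriction `h` to the nodal cubic. -/
def IsNodalQuadrature (k : ℕ) (s : K) (A : Finset (Projectivization K (Fin (r + 1) → K)))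
    (c : Projectivization K (Fin (r + 1) → K) → K) : Prop :=
  ∀ G : MvPolynomial (Fin (r + 1)) K, G.IsHomogeneous (k + k) →
    ∑ p ∈ A, c p * eval p.rep G =
      s * (aeval (nodalCurve K r) G).coeff 0 + (aeval (nodalCurve K r) G).coeff (3 * k)

theorem exists_isNodalQuadrature [IsAlgClosed K] [CharZero K] (hk : 0 < k) {a : K} (ha : a ≠ 0)
    {A : Finset (Projectivization K (Fin (r + 1) → K))}
    (hA : nodalForm K r k a ∈ decompSpan K r (k + k) ↑A) :
    ∃ c, IsNodalQuadrature k (a + a⁻¹) A c := by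
  obtain ⟨c, hc⟩ := Submodule.mem_span_image_finset_iff_exists_fun' K |>.mp hA
  have hn : ((3 * k : ℕ) : K) * a ≠ 0 := mul_ne_zero (by exact_mod_cast (by omega)) ha
  refine ⟨fun p => ((3 * k : ℕ) * a)⁻¹ * c p, fun G hG => ?_⟩
  have := sum_eval_eq_of_sum_linForm_pow_eq (d := k + k) (v := Projectivization.rep)
    (w := nodalPoint K r) (s := A) (t := Polynomial.nthRootsFinset (3 * k) a) (a := c)
    (b := fun _ => 1) (by simpa [nodalForm, powForm_eq] using hc) hG
  simp only [one_mul, sum_eval_nodalPoint hk ha hG] at this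
  simp_rw [mul_assoc _⁻¹, ← Finset.mul_sum, this]
  rw [inv_mul_cancel_left₀ hn]

theorem eq_zero_of_nodal_pairing_eq_zero (hk : 0 < k) {s : K} (hs : s + 2 ≠ 0) {h : Polynomial K}
    (hh : h ∈ nodalSubmodule K k)
    (H : ∀ g ∈ nodalSubmodule K k, s * (h * g).coeff 0 + (h * g).coeff (3 * k) = 0) : h = 0 := by
  have mid : ∀ j, 0 < j → j < 3 * k → h.coeff j = 0 := by
    intro j hj hj'
    have := H _ (X_pow_mem_nodalSubmodule (j := 3 * k - j) (by omega) (by omega))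
    rwa [Polynomial.coeff_mul_X_pow', Polynomial.coeff_mul_X_pow', if_neg (by omega),
      if_pos (by omega), mul_zero, zero_add, show 3 * k - (3 * k - j) = j by omega] at this
  have zero : h.coeff 0 = 0 := by
    have := H _ (one_add_X_pow_mem_nodalSubmodule hk)
    rw [mul_add, mul_one, Polynomial.coeff_add, Polynomial.coeff_add, Polynomial.coeff_mul_X_pow',
      Polynomial.coeff_mul_X_pow', if_neg (by omega), if_pos le_rfl, Nat.sub_self, ← hh.2] at this
    have h2 : (s + 2) * h.coeff 0 = 0 := by linear_combination this
    exact (mul_eq_zero.mp h2).resolve_left hs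
  ext j
  rw [Polynomial.coeff_zero]
  rcases Nat.lt_trichotomy j (3 * k) with hj | rfl | hj
  · rcases Nat.eq_zero_or_pos j with rfl | hj0
    · exact zero
    · exact mid j hj0 hj
  · rw [← hh.2, zero]
  · exact Polynomial.coeff_eq_zero_of_natDegree_lt (hh.1.trans_lt hj)

namespace IsNodalQuadrature

variable {s : K} {A : Finset (Projectivization K (Fin (r + 1) → K))}
  {c : Projectivization K (Fin (r + 1) → K) → K}

theorem aeval_eq_zero (hA : IsNodalQuadrature k s A c) (hr : 2 ≤ r) (hk : 0 < k) (hs : s + 2 ≠ 0)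
    {G : MvPolynomial (Fin (r + 1)) K} (hG : G.IsHomogeneous k)
    (h0 : ∀ p ∈ A, eval p.rep G = 0) : aeval (nodalCurve K r) G = 0 := by
  refine eq_zero_of_nodal_pairing_eq_zero hk hs (aeval_nodalCurve_mem hG) fun g hg => ?_
  obtain ⟨G', hG', rfl⟩ := exists_isHomogeneous_aeval_eq hr hk hg
  rw [← map_mul, ← hA _ (hG.mul hG')]
  exact Finset.sum_eq_zero fun p hp => by simp [h0 p hp]

theorem exists_injective_eval (hA : IsNodalQuadrature k s A c) (hr : 2 ≤ r) (hk : 0 < k)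
    (hs : s + 2 ≠ 0) :
    ∃ E : (Fin (3 * k) → K) →ₗ[K] (A → K), Function.Injective E ∧
      ∀ x, ∃ G : MvPolynomial (Fin (r + 1)) K, G.IsHomogeneous k ∧
        ∀ p : A, E x p = eval p.1.rep G := by
  have hbasis : ∀ j : Fin (3 * k), ∃ G : MvPolynomial (Fin (r + 1)) K, G.IsHomogeneous k ∧
      ∀ i : Fin (3 * k), (aeval (nodalCurve K r) G).coeff i = if i = j then 1 else 0 := by
    intro j
    obtain ⟨hX, G₀, hG₀, eG₀⟩ := exists_isHomogeneous_aeval_eq_X_pow (K := K) hr hk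
    rcases Nat.eq_zero_or_pos j with hj | hj
    · refine ⟨G₀, hG₀, fun i => ?_⟩
      simp [eG₀, Polynomial.coeff_one, Polynomial.coeff_X_pow, i.2.ne, Fin.ext_iff, hj]
    · obtain ⟨G, hG, eG⟩ := hX j hj j.2
      exact ⟨G, hG, fun i => by simp [eG, Polynomial.coeff_X_pow, Fin.ext_iff]⟩
  choose B hB eB using hbasis
  let L := Fintype.linearCombination K B
  have hL : ∀ x, (L x).IsHomogeneous k := fun x => by
    rw [Fintype.linearCombination_apply]
    exact Submodule.sum_mem (homogeneousSubmodule _ K k) fun j _ => Submodule.smul_mem _ _ (hB j)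
  let E : (Fin (3 * k) → K) →ₗ[K] (A → K) :=
    LinearMap.pi fun p : A => (aeval (R := K) p.1.rep).toLinearMap ∘ₗ L
  have hE : ∀ x (p : A), E x p = eval p.1.rep (L x) := fun x p => by simp [E]
  refine ⟨E, (injective_iff_map_eq_zero E).mpr fun x hx => ?_, fun x => ⟨L x, hL x, hE x⟩⟩
  have h0 := hA.aeval_eq_zero hr hk hs (hL x) fun p hp => by
    rw [← hE x ⟨p, hp⟩, hx, Pi.zero_apply]
  ext i
  have := congrArg (fun h => Polynomial.coeff h i) h0
  simpa [L, Fintype.linearCombination_apply, Polynomial.finsetSum_coeff, eB] using this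

theorem le_card (hA : IsNodalQuadrature k s A c) (hr : 2 ≤ r) (hk : 0 < k) (hs : s + 2 ≠ 0) :
    3 * k ≤ A.card := by
  obtain ⟨E, hE, -⟩ := hA.exists_injective_eval hr hk hs
  simpa using LinearMap.finrank_le_finrank_of_injective hE

theorem exists_dual (hA : IsNodalQuadrature k s A c) (hr : 2 ≤ r) (hk : 0 < k) (hs : s + 2 ≠ 0)
    (hcard : A.card = 3 * k) {p : Projectivization K (Fin (r + 1) → K)} (hp : p ∈ A) :
    ∃ G : MvPolynomial (Fin (r + 1)) K, G.IsHomogeneous k ∧ eval p.rep G = 1 ∧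
      ∀ q ∈ A, q ≠ p → eval q.rep G = 0 := by
  classical
  obtain ⟨E, hE, hE'⟩ := hA.exists_injective_eval hr hk hs
  have hsurj : Function.Surjective E :=
    (LinearMap.injective_iff_surjective_of_finrank_eq_finrank (by simp [hcard])).mp hE
  obtain ⟨x, hx⟩ := hsurj (Pi.single ⟨p, hp⟩ 1)
  obtain ⟨G, hG, eG⟩ := hE' x
  refine ⟨G, hG, by simp [← eG ⟨p, hp⟩, hx], fun q hq hqp => ?_⟩
  rw [← eG ⟨q, hq⟩, hx, Pi.single_eq_of_ne (by simpa using hqp)]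

theorem weight_ne_zero (hA : IsNodalQuadrature k s A c) (hr : 2 ≤ r) (hk : 0 < k) (hs : s + 2 ≠ 0)
    (hcard : A.card = 3 * k) {p : Projectivization K (Fin (r + 1) → K)} (hp : p ∈ A) :
    c p ≠ 0 := by
  classical
  intro hc
  have hA' : IsNodalQuadrature k s (A.erase p) c := fun G hG => by
    rw [← hA G hG, Finset.sum_erase _ (by simp [hc])]
  have := hA'.le_card hr hk hs
  have := Finset.card_erase_lt_of_mem hp
  omega

theorem eval_eq_zero_of_aeval_eq_zero (hA : IsNodalQuadrature k s A c) (hr : 2 ≤ r) (hk : 0 < k)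
    (hs : s + 2 ≠ 0) (hcard : A.card = 3 * k) {p : Projectivization K (Fin (r + 1) → K)}
    (hp : p ∈ A) {e : ℕ} (he : e ≤ k) {g : MvPolynomial (Fin (r + 1)) K} (hg : g.IsHomogeneous e)
    (h0 : aeval (nodalCurve K r) g = 0) : eval p.rep g = 0 := by
  obtain ⟨G, hG, eG, hG'⟩ := hA.exists_dual hr hk hs hcard hp
  obtain ⟨i, hi⟩ := Function.ne_iff.mp p.rep_nonzero
  have hom : (g * G * X i ^ (k - e)).IsHomogeneous (k + k) := by
    have := (hg.mul hG).mul ((isHomogeneous_X K i).pow (k - e))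
    rwa [show e + k + 1 * (k - e) = k + k by omega] at this
  have key := hA _ hom
  rw [Finset.sum_eq_single_of_mem p hp fun q hq hqp => by simp [hG' q hq hqp]] at key
  simp only [map_mul, h0, eG, zero_mul, Polynomial.coeff_zero, mul_zero, add_zero, mul_one, map_pow,
    eval_X, mul_eq_zero, hA.weight_ne_zero hr hk hs hcard hp, false_or] at key
  exact key.resolve_right (pow_ne_zero _ hi)

end IsNodalQuadrature

end NodalForm

section Decompositions

variable {K : Type} [Field K] {r k : ℕ}

theorem nodalPoint_apply_zero (t : K) : nodalPoint K r t ⟨0, by omega⟩ = 1 + t ^ 3 := by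
  simp [nodalPoint, nodalCurve]

theorem nodalPoint_apply_one (hr : 2 ≤ r) (t : K) : nodalPoint K r t ⟨1, by omega⟩ = t := by
  simp [nodalPoint, nodalCurve]

theorem nodalPoint_apply_two (hr : 2 ≤ r) (t : K) : nodalPoint K r t ⟨2, by omega⟩ = t ^ 2 := by
  simp [nodalPoint, nodalCurve]

theorem nodalPoint_ne_zero (hr : 2 ≤ r) (t : K) : nodalPoint K r t ≠ 0 := by
  intro h
  have h0 := congrFun h ⟨0, by omega⟩
  have h1 := congrFun h ⟨1, by omega⟩
  rw [nodalPoint_apply_zero, Pi.zero_apply] at h0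
  rw [nodalPoint_apply_one hr, Pi.zero_apply] at h1
  simp [h1] at h0

/-- The projective point of the nodal cubic with parameter `t`. -/
noncomputable def nodalProj (K : Type) [Field K] {r : ℕ} (hr : 2 ≤ r) (t : K) :
    Projectivization K (Fin (r + 1) → K) :=
  Projectivization.mk K (nodalPoint K r t) (nodalPoint_ne_zero hr t)

theorem nodalProj_injOn (hr : 2 ≤ r) : Set.InjOn (nodalProj K hr) {t | t ≠ 0} := by
  intro t ht u hu h
  obtain ⟨a, ha⟩ := (Projectivization.mk_eq_mk_iff' K _ _ _ _).mp h
  have h1 := congrFun ha ⟨1, by omega⟩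
  have h2 := congrFun ha ⟨2, by omega⟩
  rw [Pi.smul_apply, nodalPoint_apply_one hr, nodalPoint_apply_one hr, smul_eq_mul] at h1
  rw [Pi.smul_apply, nodalPoint_apply_two hr, nodalPoint_apply_two hr, smul_eq_mul] at h2
  have h3 : t * (t - u) = 0 := by linear_combination u * h1 - h2
  exact sub_eq_zero.mp ((mul_eq_zero.mp h3).resolve_left ht)

theorem fin_eq_or_three_le (h1 : 1 < r + 1) (h2 : 2 < r + 1) (i : Fin (r + 1)) :
    i = ⟨0, r.succ_pos⟩ ∨ i = ⟨1, h1⟩ ∨ i = ⟨2, h2⟩ ∨ 3 ≤ i.val := by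
  simp only [Fin.ext_iff]
  omega

theorem exists_nodalProj_eq (hr : 2 ≤ r) (p : Projectivization K (Fin (r + 1) → K))
    (hp : ∀ i : Fin (r + 1), 3 ≤ i.val → p.rep i = 0)
    (hcubic : p.rep ⟨0, by omega⟩ * p.rep ⟨1, by omega⟩ * p.rep ⟨2, by omega⟩ =
      p.rep ⟨1, by omega⟩ ^ 3 + p.rep ⟨2, by omega⟩ ^ 3) :
    ∃ t, nodalProj K hr t = p := by
  suffices ∃ t a, a • p.rep = nodalPoint K r t by
    obtain ⟨t, a, h⟩ := this
    refine ⟨t, ?_⟩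
    rw [← p.mk_rep]
    exact (Projectivization.mk_eq_mk_iff' K _ _ _ _).mpr ⟨a, h⟩
  generalize hx : p.rep ⟨0, by omega⟩ = x at hcubic
  generalize hy : p.rep ⟨1, by omega⟩ = y at hcubic
  generalize hz : p.rep ⟨2, by omega⟩ = z at hcubic
  have smul_rep_eq : ∀ t a, a * x = 1 + t ^ 3 → a * y = t → a * z = t ^ 2 →
      a • p.rep = nodalPoint K r t := by
    intro t a h0 h1 h2
    funext i
    rcases fin_eq_or_three_le (by omega) (by omega) i with rfl | rfl | rfl | h
    · rw [nodalPoint_apply_zero, Pi.smul_apply, hx, smul_eq_mul, h0]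
    · rw [nodalPoint_apply_one hr, Pi.smul_apply, hy, smul_eq_mul, h1]
    · rw [nodalPoint_apply_two hr, Pi.smul_apply, hz, smul_eq_mul, h2]
    · rw [Pi.smul_apply, hp i h]
      simp [nodalPoint, nodalCurve, show i.val ≠ 0 by omega, show i.val ≠ 1 by omega,
        show i.val ≠ 2 by omega]
  by_cases hy0 : y = 0
  · have hz0 : z = 0 := by simpa [hy0] using hcubic.symm
    have hx0 : x ≠ 0 := by
      rintro rfl
      refine p.rep_nonzero (funext fun i => ?_)
      rcases fin_eq_or_three_le (by omega) (by omega) i with rfl | rfl | rfl | h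
      · exact hx
      · exact hy.trans hy0
      · exact hz.trans hz0
      · exact hp i h
    exact ⟨0, x⁻¹, smul_rep_eq _ _ (by simp [hx0]) (by simp [hy0]) (by simp [hz0])⟩
  · have hz0 : z ≠ 0 := by
      rintro rfl
      exact hy0 (by simpa using hcubic.symm)
    refine ⟨z / y, z / y ^ 2, smul_rep_eq _ _ ?_ ?_ ?_⟩
    · field_simp
      linear_combination hcubic
    · field_simp
    · field_simp

/-- The points of the nodal cubic whose parameters are the `3 * k`-th roots of `a`. -/
noncomputable def nodalDecomp (K : Type) [Field K] {r : ℕ} (hr : 2 ≤ r) (k : ℕ) (a : K) :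
    Finset (Projectivization K (Fin (r + 1) → K)) :=
  open scoped Classical in (Polynomial.nthRootsFinset (3 * k) a).image (nodalProj K hr)

theorem mem_nodalDecomp (hr : 2 ≤ r) (hk : 0 < k) {a : K}
    {p : Projectivization K (Fin (r + 1) → K)} :
    p ∈ nodalDecomp K hr k a ↔ ∃ t, t ^ (3 * k) = a ∧ nodalProj K hr t = p := by
  simp [nodalDecomp, Polynomial.mem_nthRootsFinset (show 0 < 3 * k by omega)]

theorem nodalForm_mem_decompSpan (hr : 2 ≤ r) (hk : 0 < k) (a : K) :
    nodalForm K r k a ∈ decompSpan K r (k + k) ↑(nodalDecomp K hr k a) := by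
  refine Submodule.sum_mem _ fun t ht => ?_
  obtain ⟨u, hu⟩ := Projectivization.exists_smul_eq_mk_rep K _ (nodalPoint_ne_zero hr t)
  have hmem : powForm K r (k + k) (nodalProj K hr t) ∈
      decompSpan K r (k + k) ↑(nodalDecomp K hr k a) :=
    Submodule.subset_span ⟨_, (mem_nodalDecomp hr hk).mpr
      ⟨t, (Polynomial.mem_nthRootsFinset (by omega) a).mp ht, rfl⟩, rfl⟩
  have heq : powForm K r (k + k) (nodalProj K hr t) =
      (u : K) ^ (k + k) • linForm (nodalPoint K r t) ^ (k + k) := by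
    rw [powForm_eq, nodalProj, ← hu, Units.smul_def, linForm_smul, mul_pow, ← C_pow, smul_eq_C_mul]
  rw [heq] at hmem
  exact (Submodule.smul_mem_iff _ (pow_ne_zero _ u.ne_zero)).mp hmem

theorem card_nodalDecomp [IsAlgClosed K] [CharZero K] (hr : 2 ≤ r) (hk : 0 < k) {a : K}
    (ha : a ≠ 0) :
    (nodalDecomp K hr k a).card = 3 * k := by
  have hn : 0 < 3 * k := by omega
  classical
  rw [nodalDecomp, Finset.card_image_of_injOn, card_nthRootsFinset_of_ne_zero hn ha]
  refine (nodalProj_injOn hr).mono fun t ht => ?_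
  rintro rfl
  have := (Polynomial.mem_nthRootsFinset hn a).mp ht
  exact ha (by rw [← this, zero_pow hn.ne'])

theorem nodalForm_mem_decompSpan_inv [IsAlgClosed K] [CharZero K] (hr : 2 ≤ r) (hk : 0 < k) {a : K}
    (ha : a ≠ 0) :
    nodalForm K r k a ∈ decompSpan K r (k + k) ↑(nodalDecomp K hr k a⁻¹) := by
  rw [← smul_nodalForm_inv hk ha]
  exact Submodule.smul_mem _ _ (nodalForm_mem_decompSpan hr hk a⁻¹)

theorem nodalDecomp_ne [IsAlgClosed K] (hr : 2 ≤ r) (hk : 0 < k) {a b : K} (ha : a ≠ 0)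
    (hb : b ≠ 0) (hab : a ≠ b) : nodalDecomp K hr k a ≠ nodalDecomp K hr k b := by
  intro h
  have hn : 3 * k ≠ 0 := by omega
  obtain ⟨t, rfl⟩ := IsAlgClosed.exists_pow_nat_eq a (show 0 < 3 * k by omega)
  have ht : nodalProj K hr t ∈ nodalDecomp K hr k (t ^ (3 * k)) :=
    (mem_nodalDecomp hr hk).mpr ⟨t, rfl, rfl⟩
  rw [h, mem_nodalDecomp hr hk] at ht
  obtain ⟨u, rfl, hu⟩ := ht
  rw [nodalProj_injOn hr (ne_zero_pow hn hb) (ne_zero_pow hn ha) hu] at hab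
  exact hab rfl

namespace IsNodalQuadrature

variable {s : K} {A : Finset (Projectivization K (Fin (r + 1) → K))}
  {c : Projectivization K (Fin (r + 1) → K) → K}

theorem exists_nodalProj (hA : IsNodalQuadrature k s A c) (hr : 2 ≤ r) (hk : 3 ≤ k)
    (hs : s + 2 ≠ 0) (hcard : A.card = 3 * k) {p : Projectivization K (Fin (r + 1) → K)}
    (hp : p ∈ A) : ∃ t, nodalProj K hr t = p := by
  have hvanish := @eval_eq_zero_of_aeval_eq_zero K _ r k s A c hA hr (by omega) hs hcard p hp
  refine exists_nodalProj_eq hr p (fun i hi => ?_) ?_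
  · simpa using hvanish (by omega) (isHomogeneous_X K i)
      (by simp [nodalCurve, show i.val ≠ 0 by omega, show i.val ≠ 1 by omega,
        show i.val ≠ 2 by omega])
  · have hX := fun i => isHomogeneous_X K (i : Fin (r + 1))
    have := hvanish hk ((((hX ⟨0, by omega⟩).mul (hX ⟨1, by omega⟩)).mul (hX ⟨2, by omega⟩)).sub
      (((hX ⟨1, by omega⟩).pow 3).add ((hX ⟨2, by omega⟩).pow 3)))
      (by simp [nodalCurve]; ring)
    simpa [sub_eq_zero] using this

theorem eq_nodalDecomp [IsAlgClosed K] [CharZero K] {a : K} (ha : a ≠ 0)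
    (hA : IsNodalQuadrature k (a + a⁻¹) A c) (hr : 2 ≤ r) (hk : 3 ≤ k)
    (hs : a + a⁻¹ + 2 ≠ 0) (hcard : A.card = 3 * k) :
    A = nodalDecomp K hr k a ∨ A = nodalDecomp K hr k a⁻¹ := by
  have hk0 : 0 < k := by omega
  have hpar : ∀ p, ∃ t, p ∈ A → nodalProj K hr t = p := fun p => by
    by_cases hp : p ∈ A
    · obtain ⟨t, ht⟩ := hA.exists_nodalProj hr hk hs hcard hp
      exact ⟨t, fun _ => ht⟩
    · exact ⟨0, fun h => absurd h hp⟩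
  choose τ hτ using hpar
  let Q : Polynomial K := ∏ p ∈ A, (Polynomial.X - Polynomial.C (τ p))
  have hmonic : Q.Monic := Polynomial.monic_prod_X_sub_C _ _
  have hdeg : Q.natDegree = 3 * k := by rw [Polynomial.natDegree_finsetProd_X_sub_C_eq_card, hcard]
  have hroot : ∀ p ∈ A, Q.eval (τ p) = 0 := fun p hp => by
    rw [Polynomial.eval_prod]
    exact Finset.prod_eq_zero hp (by simp)
  have htop : Q.coeff (3 * k) = 1 := by rw [← hdeg]; exact hmonic
  have horth : ∀ u : Polynomial K, Q * u ∈ nodalSubmodule K (k + k) →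
      (a + a⁻¹) * (Q * u).coeff 0 + (Q * u).coeff (3 * k) = 0 := by
    intro u hu
    obtain ⟨G, hG, eG⟩ := exists_isHomogeneous_aeval_eq hr (by omega) hu
    rw [← eG, ← hA G hG]
    refine Finset.sum_eq_zero fun p hp => ?_
    obtain ⟨v, hv⟩ := Projectivization.exists_smul_eq_mk_rep K _ (nodalPoint_ne_zero hr (τ p))
    have hrep : p.rep = (v : K) • nodalPoint K r (τ p) := by
      conv_lhs => rw [← hτ p hp, nodalProj, ← hv, Units.smul_def]
    rw [hrep, eval_smul_of_isHomogeneous hG, eval_nodalPoint, eG, Polynomial.eval_mul, hroot p hp]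
    ring
  have hmid : ∀ j, 0 < j → j < 3 * k → Q.coeff j = 0 := by
    intro j hj hj'
    have := horth (Polynomial.X ^ (3 * k - j)) ⟨?_, ?_⟩
    · rwa [Polynomial.coeff_mul_X_pow', Polynomial.coeff_mul_X_pow', if_neg (by omega),
        if_pos (by omega), mul_zero, zero_add, show 3 * k - (3 * k - j) = j by omega] at this
    · refine Polynomial.natDegree_mul_le.trans ?_
      rw [hdeg, Polynomial.natDegree_X_pow]
      omega
    · rw [Polynomial.coeff_mul_X_pow', Polynomial.coeff_mul_X_pow', if_neg (by omega),
        if_pos (by omega), Polynomial.coeff_eq_zero_of_natDegree_lt (by omega)]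
  have hconst : (Q.coeff 0 + a) * (Q.coeff 0 + a⁻¹) = 0 := by
    have h1 : (Q * (1 + Polynomial.C (Q.coeff 0) * Polynomial.X ^ (3 * k))) =
      Q + Polynomial.C (Q.coeff 0) * (Q * Polynomial.X ^ (3 * k)) := by ring
    have := horth (1 + Polynomial.C (Q.coeff 0) * Polynomial.X ^ (3 * k)) ⟨?_, ?_⟩
    · rw [h1, Polynomial.coeff_add, Polynomial.coeff_add, Polynomial.coeff_C_mul,
        Polynomial.coeff_C_mul, Polynomial.coeff_mul_X_pow', Polynomial.coeff_mul_X_pow',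
        if_neg (by omega), if_pos le_rfl, Nat.sub_self, htop] at this
      linear_combination this + mul_inv_cancel₀ ha
    · refine Polynomial.natDegree_mul_le.trans ?_
      have : (1 + Polynomial.C (Q.coeff 0) * Polynomial.X ^ (3 * k)).natDegree ≤ 3 * k :=
        Polynomial.natDegree_add_le_of_degree_le (by simp) (Polynomial.natDegree_C_mul_X_pow_le _ _)
      omega
    · rw [h1, Polynomial.coeff_add, Polynomial.coeff_add, Polynomial.coeff_C_mul,
        Polynomial.coeff_C_mul, Polynomial.coeff_mul_X_pow', Polynomial.coeff_mul_X_pow',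
        if_neg (by omega), if_pos (by omega),
        Polynomial.coeff_eq_zero_of_natDegree_lt (n := 3 * (k + k)) (by omega),
        show 3 * (k + k) - 3 * k = 3 * k by omega, htop]
      ring
  have hQ : Q = Polynomial.X ^ (3 * k) + Polynomial.C (Q.coeff 0) := by
    ext j
    rw [Polynomial.coeff_add, Polynomial.coeff_X_pow, Polynomial.coeff_C]
    rcases Nat.lt_trichotomy j (3 * k) with hj | rfl | hj
    · rcases Nat.eq_zero_or_pos j with rfl | hj0
      · simp [hj.ne]
      · simp [hmid j hj0 hj, hj.ne, hj0.ne']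
    · rw [htop, if_pos rfl, if_neg (by omega), add_zero]
    · rw [Polynomial.coeff_eq_zero_of_natDegree_lt (by omega), if_neg (by omega),
        if_neg (by omega), add_zero]
  have hpow : ∀ p ∈ A, τ p ^ (3 * k) = -Q.coeff 0 := fun p hp => by
    have := hroot p hp
    rw [hQ, Polynomial.eval_add, Polynomial.eval_pow, Polynomial.eval_X, Polynomial.eval_C] at this
    exact eq_neg_of_add_eq_zero_left this
  have hfin : ∀ b : K, b ≠ 0 → -Q.coeff 0 = b → A = nodalDecomp K hr k b := fun b hb hQb =>
    Finset.eq_of_subset_of_card_le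
      (fun p hp => (mem_nodalDecomp hr hk0).mpr ⟨τ p, (hpow p hp).trans hQb, hτ p hp⟩)
      (by rw [card_nodalDecomp hr hk0 hb, hcard])
  rcases mul_eq_zero.mp hconst with h | h
  · exact .inl (hfin a ha (by rw [eq_neg_of_add_eq_zero_left h, neg_neg]))
  · exact .inr (hfin a⁻¹ (inv_ne_zero ha) (by rw [eq_neg_of_add_eq_zero_left h, neg_neg]))

end IsNodalQuadrature

theorem symRank_nodalForm [IsAlgClosed K] [CharZero K] (hr : 2 ≤ r) (hk : 0 < k) {a : K}
    (ha : a ≠ 0) (hs : a + a⁻¹ + 2 ≠ 0) :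
    symRank K r (k + k) (nodalForm K r k a) = 3 * k := by
  have hmem : ∃ A : Finset (Projectivization K (Fin (r + 1) → K)),
      A.card = 3 * k ∧ nodalForm K r k a ∈ decompSpan K r (k + k) ↑A :=
    ⟨_, card_nodalDecomp hr hk ha, nodalForm_mem_decompSpan hr hk a⟩
  refine le_antisymm (Nat.sInf_le hmem) (le_csInf ⟨_, hmem⟩ ?_)
  rintro n ⟨A, rfl, hA⟩
  obtain ⟨c, hc⟩ := exists_isNodalQuadrature hk ha hA
  exact hc.le_card hr hk hs

theorem decompSet_nodalForm [IsAlgClosed K] [CharZero K] (hr : 2 ≤ r) (hk : 3 ≤ k) {a : K}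
    (ha : a ≠ 0) (hs : a + a⁻¹ + 2 ≠ 0) :
    decompSet K r (k + k) (nodalForm K r k a) =
      {nodalDecomp K hr k a, nodalDecomp K hr k a⁻¹} := by
  have hk0 : 0 < k := by omega
  ext A
  simp only [decompSet, Set.mem_ofPred_eq, symRank_nodalForm hr hk0 ha hs, Set.mem_insert_iff,
    Set.mem_singleton_iff]
  constructor
  · rintro ⟨hA, hcard⟩
    obtain ⟨c, hc⟩ := exists_isNodalQuadrature hk0 ha hA
    exact hc.eq_nodalDecomp ha hr hk hs hcard
  · rintro (rfl | rfl)
    · exact ⟨nodalForm_mem_decompSpan hr hk0 a, card_nodalDecomp hr hk0 ha⟩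
    · exact ⟨nodalForm_mem_decompSpan_inv hr hk0 ha, card_nodalDecomp hr hk0 (inv_ne_zero ha)⟩

end Decompositions

/-- Example 3.5: for even `d ≥ 6` and `r ≥ 2` there is a nonzero
degree-`d` form `f` with `sr(f) = 3d/2` whose rank is computed by exactly two
subsets of `ℙ^r`. -/
theorem stmt_15 {K : Type} [Field K] [IsAlgClosed K] [CharZero K]
    {r d : ℕ} (hr : 2 ≤ r) (hd : 6 ≤ d) (hde : Even d) :
    ∃ f : MvPolynomial (Fin (r + 1)) K, f ≠ 0 ∧ f.IsHomogeneous d ∧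
      2 * symRank K r d f = 3 * d ∧ (decompSet K r d f).ncard = 2 := by
  obtain ⟨k, rfl⟩ := hde
  have hk : 3 ≤ k := by omega
  have h2 : (2 : K) ≠ 0 := two_ne_zero
  have hs : (2 : K) + 2⁻¹ + 2 ≠ 0 := by norm_num
  have hrank := symRank_nodalForm (K := K) hr (show 0 < k by omega) h2 hs
  refine ⟨nodalForm K r k 2, fun h0 => ?_, isHomogeneous_nodalForm 2, by omega, ?_⟩
  · have : symRank K r (k + k) (nodalForm K r k 2) ≤ 0 :=
      Nat.sInf_le ⟨∅, by simp, by rw [h0]; exact zero_mem _⟩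
    omega
  · rw [decompSet_nodalForm hr hk h2 hs]
    exact Set.ncard_pair (nodalDecomp_ne hr (by omega) h2 (inv_ne_zero h2) (by norm_num))
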